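/- arXiv:1201.3870 — 9 statements merged into one kernel-verified Lean document; each statement's English description precedes it below -/
import Mathlib

section
/- Let E be a nonzero finite-dimensional real vector space and let σ₁, σ₂ : ℍ → End_ℝ(E) be two morphisms of unital ℝ-algebras such that { σ₁(q) : q a unit imaginary quaternion } = { σ₂(q) : q a unit imaginary quaternion }. Then there exists an ℝ-algebra automorphism a of ℍ with σ₂ = σ₁ ∘ a; that is, the set Z of admissible complex structures determines the linear quaternionic structure of E. -/
/-- The set of unit imaginary quaternions: real part `0` and norm `1`. -/
def unitImaginary : Set (Quaternion ℝ) := {q | q.re = 0 ∧ ‖q‖ = 1}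

theorem exists_smul_unitImaginary {q : Quaternion ℝ} (hq : q.re = 0) (h0 : q ≠ 0) :
    ∃ u ∈ unitImaginary, q = ‖q‖ • u := by
  have hn : ‖q‖ ≠ 0 := norm_ne_zero_iff.mpr h0
  refine ⟨‖q‖⁻¹ • q, ⟨by simp [hq], ?_⟩, (smul_inv_smul₀ hn q).symm⟩
  rw [norm_smul, norm_inv, norm_norm, inv_mul_cancel₀ hn]

theorem range_le_range_of_image_unitImaginary_subset {A : Type*} [Ring A] [Algebra ℝ A]
    {f g : Quaternion ℝ →ₐ[ℝ] A} (h : (⇑f) '' unitImaginary ⊆ (⇑g) '' unitImaginary) :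
    f.range ≤ g.range := by
  rintro _ ⟨q, rfl⟩
  change f q ∈ g.range
  have him : f q.im ∈ g.range := by
    by_cases h0 : q.im = 0
    · rw [h0, map_zero]
      exact zero_mem _
    · obtain ⟨u, hu, hq⟩ := exists_smul_unitImaginary (Quaternion.re_im q) h0
      obtain ⟨v, -, hv⟩ := h ⟨u, hu, rfl⟩
      rw [hq, map_smul, ← hv]
      exact g.range.smul_mem ⟨v, rfl⟩ _
  have hre : f (q.re : Quaternion ℝ) ∈ g.range := by
    rw [← Quaternion.algebraMap_def, AlgHom.commutes]
    exact g.range.algebraMap_mem _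
  rw [← Quaternion.re_add_im q, map_add]
  exact add_mem hre him

/-- If two unital `ℝ`-algebra morphisms `σ₁, σ₂ : ℍ → End_ℝ(E)`, on a nonzero
finite-dimensional real vector space `E`, have the same set of admissible complex structures
then they differ by an `ℝ`-algebra automorphism of `ℍ`: the set `Z` of admissible complex
structures determines the linear quaternionic structure. -/
theorem stmt_3 (E : Type) [AddCommGroup E] [Module ℝ E] [FiniteDimensional ℝ E] [Nontrivial E]
    (σ₁ σ₂ : Quaternion ℝ →ₐ[ℝ] Module.End ℝ E)
    (h : (⇑σ₁) '' unitImaginary = (⇑σ₂) '' unitImaginary) :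
    ∃ a : Quaternion ℝ ≃ₐ[ℝ] Quaternion ℝ, σ₂ = σ₁.comp a.toAlgHom := by
  have hinj₁ : Function.Injective σ₁ := σ₁.toRingHom.injective
  have hinj₂ : Function.Injective σ₂ := σ₂.toRingHom.injective
  have hrange : σ₂.range = σ₁.range :=
    le_antisymm (range_le_range_of_image_unitImaginary_subset h.ge)
      (range_le_range_of_image_unitImaginary_subset h.le)
  refine ⟨((AlgEquiv.ofInjective σ₂ hinj₂).trans (Subalgebra.equivOfEq _ _ hrange)).trans
    (AlgEquiv.ofInjective σ₁ hinj₁).symm, AlgHom.ext fun q => ?_⟩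
  exact (congrArg Subtype.val ((AlgEquiv.ofInjective σ₁ hinj₁).apply_symm_apply
    (Subalgebra.equivOfEq _ _ hrange (AlgEquiv.ofInjective σ₂ hinj₂ q)))).symm
end

section
/- Every ℝ-algebra automorphism a of ℍ is inner by a unit quaternion: there exists u ∈ ℍ with ‖u‖ = 1 such that a(x) = u * x * u⁻¹ for all x ∈ ℍ. In particular, a fixes every real quaternion, preserves the norm, and maps the real subspace of imaginary quaternions onto itself. -/
namespace Quaternion

theorem re_mul_comm (x y : Quaternion ℝ) : (x * y).re = (y * x).re := by
  simp only [re_mul]; ring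

/-- If `i, j, k` and `I, J, K` both satisfy the quaternion relations, averaging any `y` over the
quaternion group gives an element intertwining `I` and `i`. -/
theorem intertwine_average {R : Type*} [Ring R] {i j k I J K : R}
    (hii : i * i = -1) (hji : j * i = -k) (hki : k * i = j)
    (hII : I * I = -1) (hIJ : I * J = K) (hIK : I * K = -J) (y : R) :
    I * (y - I * y * i - J * y * j - K * y * k) = (y - I * y * i - J * y * j - K * y * k) * i := by
  have hl : I * (y - I * y * i - J * y * j - K * y * k) =
      I * y - (I * I) * y * i - (I * J) * y * j - (I * K) * y * k := by noncomm_ring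
  have hr : (y - I * y * i - J * y * j - K * y * k) * i =
      y * i - I * y * (i * i) - J * y * (j * i) - K * y * (k * i) := by noncomm_ring
  rw [hl, hr, hii, hji, hki, hII, hIJ, hIK]
  noncomm_ring

/-- The Skolem–Noether theorem for endomorphisms of the real quaternions. -/
theorem exists_ne_zero_intertwine (a : Quaternion ℝ →ₐ[ℝ] Quaternion ℝ) :
    ∃ q : Quaternion ℝ, q ≠ 0 ∧ ∀ x, a x * q = q * x := by
  obtain ⟨i, i0, i1, i2, i3⟩ : ∃ i : Quaternion ℝ,
      i.re = 0 ∧ i.imI = 1 ∧ i.imJ = 0 ∧ i.imK = 0 :=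
    ⟨⟨0, 1, 0, 0⟩, rfl, rfl, rfl, rfl⟩
  obtain ⟨j, j0, j1, j2, j3⟩ : ∃ j : Quaternion ℝ,
      j.re = 0 ∧ j.imI = 0 ∧ j.imJ = 1 ∧ j.imK = 0 :=
    ⟨⟨0, 0, 1, 0⟩, rfl, rfl, rfl, rfl⟩
  obtain ⟨k, k0, k1, k2, k3⟩ : ∃ k : Quaternion ℝ,
      k.re = 0 ∧ k.imI = 0 ∧ k.imJ = 0 ∧ k.imK = 1 :=
    ⟨⟨0, 0, 0, 1⟩, rfl, rfl, rfl, rfl⟩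
  have hii : i * i = -1 := by ext <;> simp [i0, i1, i2, i3]
  have hjj : j * j = -1 := by ext <;> simp [j0, j1, j2, j3]
  have hkk : k * k = -1 := by ext <;> simp [k0, k1, k2, k3]
  have hij : i * j = k := by ext <;> simp [i0, i1, i2, i3, j0, j1, j2, j3, k0, k1, k2, k3]
  have hji : j * i = -k := by ext <;> simp [i0, i1, i2, i3, j0, j1, j2, j3, k0, k1, k2, k3]
  have hjk : j * k = i := by ext <;> simp [i0, i1, i2, i3, j0, j1, j2, j3, k0, k1, k2, k3]
  have hkj : k * j = -i := by ext <;> simp [i0, i1, i2, i3, j0, j1, j2, j3, k0, k1, k2, k3]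
  have hki : k * i = j := by ext <;> simp [i0, i1, i2, i3, j0, j1, j2, j3, k0, k1, k2, k3]
  have hik : i * k = -j := by ext <;> simp [i0, i1, i2, i3, j0, j1, j2, j3, k0, k1, k2, k3]
  let T : Quaternion ℝ → Quaternion ℝ := fun y => y - a i * y * i - a j * y * j - a k * y * k
  have hTi (y) : a i * T y = T y * i :=
    intertwine_average hii hji hki (by rw [← map_mul, hii, map_neg, map_one])
      (by rw [← map_mul, hij]) (by rw [← map_mul, hik, map_neg]) y
  have hTj (y) : a j * T y = T y * j := by
    have h := intertwine_average (I := a j) (J := a k) (K := a i) hjj hkj hij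
      (by rw [← map_mul, hjj, map_neg, map_one])
      (by rw [← map_mul, hjk]) (by rw [← map_mul, hji, map_neg]) y
    have e : T y = y - a j * y * j - a k * y * k - a i * y * i := by simp only [T]; abel
    rwa [e]
  have hT (x y) : a x * T y = T y * x := by
    have hTk : a k * T y = T y * k := by
      rw [← hij, map_mul, mul_assoc, hTj, ← mul_assoc, hTi, mul_assoc]
    have hx : x = x.re • (1 : Quaternion ℝ) + x.imI • i + x.imJ • j + x.imK • k := by
      ext <;> simp [i0, i1, i2, i3, j0, j1, j2, j3, k0, k1, k2, k3]
    rw [hx]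
    simp only [map_add, map_smul, map_one, add_mul, mul_add, smul_mul_assoc, mul_smul_comm,
      hTi, hTj, hTk, one_mul, mul_one]
  have hsum : T 1 - T i * i - T j * j - T k * k = 4 • (1 : Quaternion ℝ) := by
    have h : T 1 - T i * i - T j * j - T k * k =
        (1 - i * i - j * j - k * k) - a i * (i - i * (i * i) - j * i * j - k * i * k)
          - a j * (j - i * j * i - j * (j * j) - k * j * k)
          - a k * (k - i * k * i - j * k * j - k * (k * k)) := by
      simp only [T]; noncomm_ring
    rw [h, hij, hji, hjk, hkj, hki, hik, hii, hjj, hkk]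
    simp only [neg_mul, hij, hji, hjk, hkj, hik]
    noncomm_ring
  by_contra! hcon
  have hT0 (y) : T y = 0 := by
    by_contra hy
    obtain ⟨x, hx⟩ := hcon (T y) hy
    exact hx (hT x y)
  simp only [hT0, zero_mul, sub_zero] at hsum
  have hre := congrArg QuaternionAlgebra.re hsum
  rw [re_smul, re_zero, re_one] at hre
  norm_num at hre

end Quaternion

/-- Every `ℝ`-algebra automorphism of `ℍ` is inner by a unit quaternion; in
particular it fixes every real quaternion, preserves the norm, and maps the set of purely
imaginary quaternions onto itself. -/
theorem stmt_4 (a : Quaternion ℝ ≃ₐ[ℝ] Quaternion ℝ) :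
    ∃ u : Quaternion ℝ, ‖u‖ = 1 ∧ (∀ x, a x = u * x * u⁻¹) ∧
      (∀ r : ℝ, a (r : Quaternion ℝ) = (r : Quaternion ℝ)) ∧
      (∀ x, ‖a x‖ = ‖x‖) ∧
      (⇑a) '' {q : Quaternion ℝ | q.re = 0} = {q : Quaternion ℝ | q.re = 0} := by
  obtain ⟨q, hq, hqa⟩ := Quaternion.exists_ne_zero_intertwine a.toAlgHom
  have hn : ‖q‖ ≠ 0 := norm_ne_zero_iff.mpr hq
  have hu : ‖‖q‖⁻¹ • q‖ = 1 := by rw [norm_smul, norm_inv, norm_norm, inv_mul_cancel₀ hn]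
  generalize hdef : ‖q‖⁻¹ • q = u at hu
  have hu0 : u ≠ 0 := norm_ne_zero_iff.mp (by simp [hu])
  have hinner (x) : a x = u * x * u⁻¹ := by
    have hx : a x * q = q * x := hqa x
    rw [eq_mul_inv_iff_mul_eq₀ hu0, ← hdef, mul_smul_comm, smul_mul_assoc, hx]
  have hre (x) : (a x).re = x.re := by
    rw [hinner, Quaternion.re_mul_comm, ← mul_assoc, inv_mul_cancel₀ hu0, one_mul]
  refine ⟨u, hu, hinner, a.commutes, fun x => ?_, ?_⟩
  · rw [hinner, norm_mul, norm_mul, norm_inv, hu, inv_one, one_mul, mul_one]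
  · ext y
    constructor
    · rintro ⟨x, hx, rfl⟩
      exact (hre x).trans hx
    · intro hy
      obtain ⟨x, rfl⟩ := a.surjective y
      exact ⟨x, (hre x).symm.trans hy, rfl⟩
end

section
/- Let r : ℍ → ℍ be an ℝ-linear bijection such that r(1) = 1, ‖r(x)‖ = ‖x‖ for all x ∈ ℍ, and det(r) = 1 (determinant of r as an ℝ-linear endomorphism of the 4-dimensional real vector space ℍ). Then there exists a unit quaternion u such that r(x) = u * x * u⁻¹ for all x ∈ ℍ; in particular, r is an ℝ-algebra automorphism of ℍ. (Together with the inner-automorphism theorem, this identifies the automorphism group of ℍ with SO(3, ℝ) acting canonically on the imaginary quaternions.) -/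
open Quaternion

/-- The quaternion with the given coordinates in the basis `1, i, j, k`. -/
def Quaternion.ofCoords (t x y z : ℝ) : ℍ[ℝ] := ⟨t, x, y, z⟩

section ofCoords

variable (t x y z : ℝ)

@[simp] theorem Quaternion.re_ofCoords : (ofCoords t x y z).re = t := rfl

@[simp] theorem Quaternion.imI_ofCoords : (ofCoords t x y z).imI = x := rfl

@[simp] theorem Quaternion.imJ_ofCoords : (ofCoords t x y z).imJ = y := rfl

@[simp] theorem Quaternion.imK_ofCoords : (ofCoords t x y z).imK = z := rfl

end ofCoords

theorem Quaternion.eq_smul_basis (q : ℍ[ℝ]) :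
    q = q.re • (1 : ℍ[ℝ]) + q.imI • ofCoords 0 1 0 0 + q.imJ • ofCoords 0 0 1 0
      + q.imK • ofCoords 0 0 0 1 := by
  ext <;> simp

theorem Quaternion.det_eq_of_map_one (r : ℍ[ℝ] →ₗ[ℝ] ℍ[ℝ]) (h1 : r 1 = 1) {a b c : ℍ[ℝ]}
    (ha : r (ofCoords 0 1 0 0) = a) (hb : r (ofCoords 0 0 1 0) = b)
    (hc : r (ofCoords 0 0 0 1) = c) :
    LinearMap.det r = a.imI * (b.imJ * c.imK - b.imK * c.imJ)
      - a.imJ * (b.imI * c.imK - b.imK * c.imI) + a.imK * (b.imI * c.imJ - b.imJ * c.imI) := by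
  let B : Module.Basis (Fin 4) ℝ ℍ[ℝ] := .ofEquivFun
    (linearIsometryEquivTuple.toLinearEquiv.trans (WithLp.linearEquiv 2 ℝ (Fin 4 → ℝ)))
  have hrepr (q : ℍ[ℝ]) : (B.repr q : Fin 4 → ℝ) = ![q.re, q.imI, q.imJ, q.imK] := rfl
  have e0 : B 0 = 1 := by
    rw [Module.Basis.apply_eq_iff]; ext n; rw [hrepr]; fin_cases n <;> simp
  have e1 : B 1 = ofCoords 0 1 0 0 := by
    rw [Module.Basis.apply_eq_iff]; ext n; rw [hrepr]; fin_cases n <;> simp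
  have e2 : B 2 = ofCoords 0 0 1 0 := by
    rw [Module.Basis.apply_eq_iff]; ext n; rw [hrepr]; fin_cases n <;> simp
  have e3 : B 3 = ofCoords 0 0 0 1 := by
    rw [Module.Basis.apply_eq_iff]; ext n; rw [hrepr]; fin_cases n <;> simp
  have hM : LinearMap.toMatrix B B r = !![1, a.re, b.re, c.re; 0, a.imI, b.imI, c.imI;
      0, a.imJ, b.imJ, c.imJ; 0, a.imK, b.imK, c.imK] := by
    ext m n
    rw [LinearMap.toMatrix_apply, hrepr]
    fin_cases n <;> simp only [Fin.zero_eta, Fin.mk_one, Fin.reduceFinMk, e0, e1, e2, e3, h1, ha,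
      hb, hc] <;> fin_cases m <;> simp
  rw [← LinearMap.det_toMatrix B, hM]
  simp [Matrix.det_succ_row_zero, Fin.sum_univ_succ, Fin.succAbove]
  ring

/-- Averaging `q` over two quaternionic systems gives an element intertwining them. -/
theorem intertwines_average {R : Type*} [Ring R] {a b i j : R} (q : R)
    (haa : a * a = -1) (hbb : b * b = -1) (hba : b * a = -(a * b))
    (hii : i * i = -1) (hjj : j * j = -1) (hji : j * i = -(i * j)) :
    a * (q - a * q * i - b * q * j - a * b * q * (i * j))
        = (q - a * q * i - b * q * j - a * b * q * (i * j)) * i ∧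
      b * (q - a * q * i - b * q * j - a * b * q * (i * j))
        = (q - a * q * i - b * q * j - a * b * q * (i * j)) * j := by
  have haa' (x : R) : a * (a * x) = -x := by rw [← mul_assoc, haa, neg_one_mul]
  have hbb' (x : R) : b * (b * x) = -x := by rw [← mul_assoc, hbb, neg_one_mul]
  have hba' (x : R) : b * (a * x) = -(a * (b * x)) := by
    rw [← mul_assoc, hba, neg_mul, mul_assoc]
  have hii' (x : R) : i * (i * x) = -x := by rw [← mul_assoc, hii, neg_one_mul]
  constructor <;>
  · simp only [mul_sub, sub_mul, mul_assoc, haa', hbb', hba', hii, hii', hjj, hji, mul_neg, mul_one,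
      neg_neg]
    abel

/-- The imaginary units are sent by a norm-preserving `r` with `r 1 = 1` and `det r = 1`
to a quaternionic system. -/
theorem Quaternion.map_units_of_norm_of_det (r : ℍ[ℝ] →ₗ[ℝ] ℍ[ℝ]) (h1 : r 1 = 1)
    (hnorm : ∀ x, ‖r x‖ = ‖x‖) (hdet : LinearMap.det r = 1) {a b c : ℍ[ℝ]}
    (ha : r (ofCoords 0 1 0 0) = a) (hb : r (ofCoords 0 0 1 0) = b)
    (hc : r (ofCoords 0 0 0 1) = c) :
    a * a = -1 ∧ b * b = -1 ∧ b * a = -(a * b) ∧ c = a * b := by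
  rw [det_eq_of_map_one r h1 ha hb hc] at hdet
  have key (t x y z : ℝ) : normSq (t • (1 : ℍ[ℝ]) + x • a + y • b + z • c)
      = t ^ 2 + x ^ 2 + y ^ 2 + z ^ 2 := by
    have h : normSq (r (ofCoords t x y z)) = normSq (ofCoords t x y z) := by
      simp only [normSq_eq_norm_mul_self, hnorm]
    nth_rw 1 [eq_smul_basis (ofCoords t x y z)] at h
    simp only [map_add, map_smul, h1, ha, hb, hc, re_ofCoords, imI_ofCoords, imJ_ofCoords,
      imK_ofCoords] at h
    rw [h, normSq_def']
    simp
  simp only [normSq_def', re_add, imI_add, imJ_add, imK_add, re_smul, imI_smul, imJ_smul,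
    imK_smul, re_one, imI_one, imJ_one, imK_one, smul_eq_mul] at key
  have naa := key 0 1 0 0
  have nbb := key 0 0 1 0
  have ncc := key 0 0 0 1
  have nab := key 0 1 1 0
  have ha0 : a.re = 0 := by linarith [key 1 1 0 0]
  have hb0 : b.re = 0 := by linarith [key 1 0 1 0]
  have hc0 : c.re = 0 := by linarith [key 1 0 0 1]
  ring_nf at naa nbb ncc nab
  simp only [ha0, hb0, hc0] at naa nbb ncc nab
  have dab : a.imI * b.imI + a.imJ * b.imJ + a.imK * b.imK = 0 := by linarith
  have hcross : (c.imI - (a.imJ * b.imK - a.imK * b.imJ)) ^ 2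
      + (c.imJ - (a.imK * b.imI - a.imI * b.imK)) ^ 2
      + (c.imK - (a.imI * b.imJ - a.imJ * b.imI)) ^ 2 = 0 := by
    linear_combination ncc - 2 * hdet + (b.imI ^ 2 + b.imJ ^ 2 + b.imK ^ 2) * naa + nbb
      - (a.imI * b.imI + a.imJ * b.imJ + a.imK * b.imK) * dab
  have hc1 : c.imI = a.imJ * b.imK - a.imK * b.imJ := by nlinarith
  have hc2 : c.imJ = a.imK * b.imI - a.imI * b.imK := by nlinarith
  have hc3 : c.imK = a.imI * b.imJ - a.imJ * b.imI := by nlinarith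
  refine ⟨?_, ?_, ?_, ?_⟩ <;> ext <;>
    simp only [re_mul, imI_mul, imJ_mul, imK_mul, re_neg, imI_neg, imJ_neg, imK_neg, re_one,
      imI_one, imJ_one, imK_one, ha0, hb0, hc0, hc1, hc2, hc3] <;>
    first | ring1 | linarith


/-- An `ℝ`-linear bijection `r : ℍ → ℍ` with `r 1 = 1`, preserving the norm, and
of determinant `1` (as an `ℝ`-linear endomorphism of the `4`-dimensional real vector space `ℍ`)
is conjugation by a unit quaternion; in particular it is an `ℝ`-algebra automorphism of `ℍ`. -/
theorem stmt_5 (r : Quaternion ℝ →ₗ[ℝ] Quaternion ℝ) (hbij : Function.Bijective r)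
    (h1 : r 1 = 1) (hnorm : ∀ x, ‖r x‖ = ‖x‖) (hdet : LinearMap.det r = 1) :
    ∃ u : Quaternion ℝ, ‖u‖ = 1 ∧ (∀ x, r x = u * x * u⁻¹) ∧
      ∀ x y, r (x * y) = r x * r y := by
  obtain ⟨a, ha⟩ : ∃ a, r (ofCoords 0 1 0 0) = a := ⟨_, rfl⟩
  obtain ⟨b, hb⟩ : ∃ b, r (ofCoords 0 0 1 0) = b := ⟨_, rfl⟩
  obtain ⟨c, hc⟩ : ∃ c, r (ofCoords 0 0 0 1) = c := ⟨_, rfl⟩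
  obtain ⟨haa, hbb, hba, rfl⟩ := map_units_of_norm_of_det r h1 hnorm hdet ha hb hc
  set i := ofCoords 0 1 0 0 with hi
  set j := ofCoords 0 0 1 0 with hj
  have hij : ofCoords 0 0 0 1 = i * j := by ext <;> simp [hi, hj]
  have hii : i * i = -1 := by ext <;> simp [hi]
  have hjj : j * j = -1 := by ext <;> simp [hj]
  have hji : j * i = -(i * j) := by ext <;> simp [hi, hj]
  obtain ⟨v, hv, hav, hbv⟩ : ∃ v : ℍ[ℝ], v ≠ 0 ∧ a * v = v * i ∧ b * v = v * j := by
    by_contra! hne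
    have hzero (q : ℍ[ℝ]) : q - a * q * i - b * q * j - a * b * q * (i * j) = 0 := by
      by_contra hq
      obtain ⟨h, h'⟩ := intertwines_average q haa hbb hba hii hjj hji
      exact hne _ hq h h'
    rw [← hij] at hzero
    generalize a * b = c at hzero
    have t0 := congrArg (fun q : ℍ[ℝ] => q.re) (hzero 1)
    have t1 := congrArg (fun q : ℍ[ℝ] => q.imI) (hzero (ofCoords 0 1 0 0))
    have t2 := congrArg (fun q : ℍ[ℝ] => q.imJ) (hzero (ofCoords 0 0 1 0))
    have t3 := congrArg (fun q : ℍ[ℝ] => q.imK) (hzero (ofCoords 0 0 0 1))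
    simp [hi, hj] at t0 t1 t2 t3
    linarith
  have hrv (x : ℍ[ℝ]) : r x * v = v * x := by
    have habv : a * b * v = v * (i * j) := by rw [mul_assoc, hbv, ← mul_assoc, hav, mul_assoc]
    rw [hij] at hc
    rw [eq_smul_basis x]
    simp only [map_add, map_smul, h1, ha, hb, hc, add_mul, mul_add, smul_mul_assoc,
      mul_smul_comm, one_mul, mul_one, hav, hbv, habv, hij, ← hi, ← hj]
  have hu : ‖v‖⁻¹ • v ≠ 0 := smul_ne_zero (inv_ne_zero (norm_ne_zero_iff.mpr hv)) hv
  have hconj (x : ℍ[ℝ]) : r x = (‖v‖⁻¹ • v) * x * (‖v‖⁻¹ • v)⁻¹ := by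
    rw [eq_mul_inv_iff_mul_eq₀ hu, mul_smul_comm, hrv, smul_mul_assoc]
  refine ⟨‖v‖⁻¹ • v, ?_, hconj, fun x y => ?_⟩
  · rw [norm_smul, norm_inv, norm_norm, inv_mul_cancel₀ (norm_ne_zero_iff.mpr hv)]
  · simp only [hconj, mul_assoc, inv_mul_cancel_left₀ hu]
end

section
/- Let E be a finite-dimensional real vector space endowed with a linear quaternionic structure given by a morphism of unital ℝ-algebras σ : ℍ → End_ℝ(E), and let U ⊆ E be a real vector subspace of codimension 1 (i.e., dim_ℝ U = dim_ℝ E − 1). Then for every unit imaginary quaternion q, U + σ(q)(U) = E. (This is the linear content of the statement that any hypersurface of a quaternionic manifold is a generic submanifold.) -/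
/-- A finite-dimensional real vector space with a complex structure has even dimension. -/
theorem even_finrank_of_mul_self_eq_neg_one {V : Type*} [AddCommGroup V] [Module ℝ V]
    (J : Module.End ℝ V) (hJ : J * J = -1) : Even (Module.finrank ℝ V) := by
  have hdet : LinearMap.det J * LinearMap.det J = (-1) ^ Module.finrank ℝ V := by
    rw [← map_mul, hJ, ← neg_one_smul ℝ (1 : Module.End ℝ V), LinearMap.det_smul, map_one, mul_one]
  by_contra hodd
  rw [(Nat.not_even_iff_odd.mp hodd).neg_one_pow] at hdet
  linarith [mul_self_nonneg (LinearMap.det J)]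

/-- A unit imaginary quaternion squares to `-1`. -/
theorem Quaternion.mul_self_eq_neg_one_of_re_eq_zero {q : Quaternion ℝ} (hre : q.re = 0)
    (hnorm : ‖q‖ = 1) : q * q = -1 := by
  have h := Quaternion.self_mul_star q
  rw [Quaternion.star_eq_neg.mpr hre, Quaternion.normSq_eq_norm_mul_self, hnorm, mul_neg] at h
  rw [← neg_neg (q * q), h]
  simp


/-- For a linear quaternionic structure `σ : ℍ → End_ℝ(E)` on a finite-dimensional
real vector space `E`, any real subspace `U ⊆ E` of codimension `1` satisfies
`U + σ(q)(U) = E` for every unit imaginary quaternion `q`; i.e. any hyperplane is generic. -/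
theorem stmt_6 (E : Type) [AddCommGroup E] [Module ℝ E] [FiniteDimensional ℝ E]
    (σ : Quaternion ℝ →ₐ[ℝ] Module.End ℝ E) (U : Submodule ℝ E)
    (hU : Module.finrank ℝ U = Module.finrank ℝ E - 1)
    (q : Quaternion ℝ) (hre : q.re = 0) (hnorm : ‖q‖ = 1) :
    U ⊔ U.map (σ q) = ⊤ := by
  by_contra hne
  have hJ : σ q * σ q = -1 := by
    rw [← map_mul, Quaternion.mul_self_eq_neg_one_of_re_eq_zero hre hnorm, map_neg, map_one]
  have hlt := Submodule.finrank_lt hne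
  have hsup : U = U ⊔ U.map (σ q) :=
    Submodule.eq_of_le_of_finrank_le le_sup_left (by omega)
  have hinv : ∀ x ∈ U, σ q x ∈ U := fun x hx => by
    rw [hsup]
    exact Submodule.mem_sup_right (Submodule.mem_map_of_mem hx)
  have hE := even_finrank_of_mul_self_eq_neg_one (σ q) hJ
  have hUeven := even_finrank_of_mul_self_eq_neg_one ((σ q).restrict hinv) <| by
    ext x
    exact LinearMap.congr_fun hJ x
  grind
end

section
/- Let k be a positive integer, let E = ℍ^{k+1} (maps from Fin (k+1) to ℍ) with the linear quaternionic structure given by componentwise left multiplication by quaternions, and let U ⊆ E be the real subspace of those v whose last component lies in the real span of 1 and the quaternion i. Then U has real codimension 2 in E, the endomorphism J of left multiplication by i is an admissible complex structure, and U + J(U) = U ≠ E; hence U is not a generic subspace, showing that, unlike for hypersurfaces, genericity can fail in codimension greater than 1. -/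
/-- The quaternion `i`. -/
noncomputable def qI : Quaternion ℝ := ⟨0, 1, 0, 0⟩

/-- The real subspace of `ℍ^(k+1)` of those `v` whose last component lies in the real span of
`1` and the quaternion `i`. -/
noncomputable def U7 (k : ℕ) : Submodule ℝ (Fin (k + 1) → Quaternion ℝ) :=
  Submodule.comap
    (LinearMap.proj (Fin.last k) : (Fin (k + 1) → Quaternion ℝ) →ₗ[ℝ] Quaternion ℝ)
    (Submodule.span ℝ {1, qI})

@[simp] theorem re_qI : qI.re = 0 := rfl

@[simp] theorem imI_qI : qI.imI = 1 := rfl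

@[simp] theorem imJ_qI : qI.imJ = 0 := rfl

@[simp] theorem imK_qI : qI.imK = 0 := rfl

theorem mem_span_one_qI {q : Quaternion ℝ} :
    q ∈ Submodule.span ℝ {1, qI} ↔ q.imJ = 0 ∧ q.imK = 0 := by
  rw [Submodule.mem_span_pair]
  constructor
  · rintro ⟨a, b, rfl⟩
    simp [Quaternion.imJ_one, Quaternion.imK_one]
  · rintro ⟨hj, hk⟩
    refine ⟨q.re, q.imI, ?_⟩
    ext <;> simp [hj, hk, Quaternion.re_one, Quaternion.imI_one, Quaternion.imJ_one,
      Quaternion.imK_one]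

theorem mem_U7 {k : ℕ} {v : Fin (k + 1) → Quaternion ℝ} :
    v ∈ U7 k ↔ (v (Fin.last k)).imJ = 0 ∧ (v (Fin.last k)).imK = 0 :=
  mem_span_one_qI

/-- The `j` and `k` coordinates of the last component, as a real-linear map. -/
def lastJK (k : ℕ) : (Fin (k + 1) → Quaternion ℝ) →ₗ[ℝ] ℝ × ℝ where
  toFun v := ((v (Fin.last k)).imJ, (v (Fin.last k)).imK)
  map_add' v w := by simp
  map_smul' c v := by simp

theorem ker_lastJK (k : ℕ) : LinearMap.ker (lastJK k) = U7 k := by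
  ext v
  rw [LinearMap.mem_ker, mem_U7]
  exact Prod.mk_eq_zero

theorem lastJK_surjective (k : ℕ) : Function.Surjective (lastJK k) :=
  fun p => ⟨fun _ => ⟨0, 0, p.1, p.2⟩, rfl⟩

theorem finrank_U7_add_two (k : ℕ) :
    Module.finrank ℝ (U7 k) + 2 = Module.finrank ℝ (Fin (k + 1) → Quaternion ℝ) := by
  have h := (lastJK k).finrank_range_add_finrank_ker
  rw [LinearMap.range_eq_top.2 (lastJK_surjective k), finrank_top, ker_lastJK,
    Module.finrank_prod, Module.finrank_self] at h
  omega

theorem map_lsmul_qI_U7_le (k : ℕ) :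
    (U7 k).map (Algebra.lsmul ℝ ℝ (Fin (k + 1) → Quaternion ℝ) qI) ≤ U7 k := by
  rintro _ ⟨v, hv, rfl⟩
  obtain ⟨hj, hk⟩ := mem_U7.1 hv
  refine mem_U7.2 ?_
  change (qI * v (Fin.last k)).imJ = 0 ∧ (qI * v (Fin.last k)).imK = 0
  simp [hj, hk]

theorem norm_qI : ‖qI‖ = 1 := by
  have h : ‖qI‖ * ‖qI‖ = 1 := by
    rw [← Quaternion.normSq_eq_norm_mul_self, Quaternion.normSq_def']
    simp
  nlinarith [norm_nonneg qI]

/-- In `E = ℍ^(k+1)` with the linear quaternionic structure given by componentwise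
left multiplication (the algebra morphism `Algebra.lsmul ℝ ℝ E : ℍ →ₐ[ℝ] End_ℝ(E)`), the
subspace `U` of vectors whose last component lies in `span_ℝ {1, i}` has real codimension `2`,
the endomorphism `J` of left multiplication by `i` is admissible (`i` is unit imaginary), and
`U + J(U) = U ≠ E`; hence `U` is not generic. -/
theorem stmt_7 (k : ℕ) (hk : 0 < k) :
    Module.finrank ℝ (U7 k) + 2 = Module.finrank ℝ (Fin (k + 1) → Quaternion ℝ) ∧
    qI.re = 0 ∧ ‖qI‖ = 1 ∧
    U7 k ⊔ (U7 k).map (Algebra.lsmul ℝ ℝ (Fin (k + 1) → Quaternion ℝ) qI) = U7 k ∧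
    U7 k ≠ ⊤ := by
  refine ⟨finrank_U7_add_two k, rfl, norm_qI, sup_eq_left.2 (map_lsmul_qI_U7_le k), fun h => ?_⟩
  have hfin := finrank_U7_add_two k
  rw [h, finrank_top] at hfin
  omega
end

section
/- Let k be a positive integer, let E be a real vector space with dim_ℝ E = 4k endowed with a linear quaternionic structure given by a morphism of unital ℝ-algebras σ : ℍ → End_ℝ(E), and let U ⊆ E be a real subspace such that U + σ(q)(U) = E for every unit imaginary quaternion q. Then dim_ℝ U ≥ 2k + 1; equivalently, any generic subspace of E has codimension at most 2k − 1. -/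
/-- Two commuting endomorphisms of a nonzero finite-dimensional complex space have a common
eigenvector. -/
theorem Commute.exists_common_eigenvector {W : Type*} [AddCommGroup W] [Module ℂ W]
    [FiniteDimensional ℂ W] [Nontrivial W] {A B : Module.End ℂ W} (h : Commute A B) :
    ∃ (α β : ℂ) (w : W), w ≠ 0 ∧ A w = α • w ∧ B w = β • w := by
  obtain ⟨α, hα⟩ := Module.End.exists_eigenvalue A
  have hB : ∀ x ∈ A.eigenspace α, B x ∈ A.eigenspace α := by
    intro x hx
    rw [Module.End.mem_eigenspace_iff] at hx ⊢
    have := LinearMap.congr_fun h.eq x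
    simp only [Module.End.mul_apply] at this
    rw [this, hx, map_smul]
  have : Nontrivial (A.eigenspace α) := Submodule.nontrivial_iff_ne_bot.mpr hα
  obtain ⟨β, hβ⟩ := Module.End.exists_eigenvalue (B.restrict hB)
  obtain ⟨w, hw⟩ := hβ.exists_hasEigenvector
  refine ⟨α, β, w, fun h0 => hw.2 (Subtype.ext h0), ?_, ?_⟩
  · exact Module.End.mem_eigenspace_iff.mp w.2
  · simpa using congrArg Subtype.val hw.apply_eq_smul

/-- For two commuting endomorphisms `A`, `B` of a nonzero finite-dimensional real space, some
nonzero real combination of `1`, `A`, `B` is singular. -/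
theorem Commute.exists_singular_combination {V : Type*} [AddCommGroup V] [Module ℝ V]
    [FiniteDimensional ℝ V] [Nontrivial V] {A B : Module.End ℝ V} (h : Commute A B) :
    ∃ (a b c : ℝ) (v : V), (b ≠ 0 ∨ c ≠ 0) ∧ v ≠ 0 ∧ a • v + b • A v + c • B v = 0 := by
  have hc : Commute (A.baseChange ℂ) (B.baseChange ℂ) := by
    have := congrArg (LinearMap.baseChange ℂ) h.eq
    rwa [LinearMap.baseChange_mul, LinearMap.baseChange_mul] at this
  obtain ⟨α, β, w, hw, hA, hB⟩ := hc.exists_common_eigenvector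
  obtain ⟨b, c, hbc, him⟩ : ∃ b c : ℝ, (b ≠ 0 ∨ c ≠ 0) ∧ b * α.im + c * β.im = 0 := by
    by_cases h0 : α.im = 0
    · exact ⟨1, 0, by simp, by simp [h0]⟩
    · exact ⟨β.im, -α.im, by simp [h0], by ring⟩
  let a : ℝ := -(b * α.re + c * β.re)
  let T : Module.End ℝ V := a • 1 + b • A + c • B
  have hz : (a : ℂ) + b * α + c * β = 0 := by
    apply Complex.ext
    · simp [a]
    · simpa using him
  have hT : T.baseChange ℂ w = 0 := by
    have h1 : T.baseChange ℂ w = (a : ℂ) • w + (b : ℂ) • A.baseChange ℂ w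
        + (c : ℂ) • B.baseChange ℂ w := by
      simp [T, LinearMap.baseChange_add, LinearMap.baseChange_smul, Module.End.one_eq_id]
      rfl
    rw [h1, hA, hB, smul_smul, smul_smul, ← add_smul, ← add_smul, hz, zero_smul]
  have hdet : LinearMap.det T = 0 := by
    have h2 : LinearMap.det (T.baseChange ℂ) = 0 := by
      by_contra hne
      have := (LinearMap.equivOfDetNeZero _ hne).injective
        (a₁ := w) (a₂ := 0) (by simpa using hT)
      exact hw this
    rw [LinearMap.det_baseChange] at h2
    simpa using h2
  obtain ⟨v, hv, hv0⟩ := Submodule.exists_mem_ne_zero_of_ne_bot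
    (LinearMap.bot_lt_ker_of_det_eq_zero hdet).ne'
  exact ⟨a, b, c, v, hbc, hv0, by simpa [T] using hv⟩

/-- If `U + f(U) = E` and `dim E ≥ 2 dim U`, then `(u, v) ↦ u + f v` is a linear isomorphism from
`U × U` to `E`. -/
theorem Submodule.bijective_coprod_of_sup_map_eq_top {K E : Type*} [Field K] [AddCommGroup E]
    [Module K E] [FiniteDimensional K E] {U : Submodule K E} {f : Module.End K E}
    (hf : U ⊔ U.map f = ⊤) (hd : 2 * Module.finrank K U ≤ Module.finrank K E) :
    Function.Bijective (U.subtype.coprod (f ∘ₗ U.subtype)) := by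
  have hs : Function.Surjective (U.subtype.coprod (f ∘ₗ U.subtype)) := by
    rw [← LinearMap.range_eq_top, LinearMap.range_coprod, LinearMap.range_comp,
      Submodule.range_subtype, hf]
  refine ⟨(LinearMap.injective_iff_surjective_of_finrank_eq_finrank ?_).mpr hs, hs⟩
  have := LinearMap.finrank_le_finrank_of_surjective hs
  rw [Module.finrank_prod] at this ⊢
  omega

/-- If `E` is a real vector space of dimension `4k` with a linear quaternionic
structure `σ : ℍ → End_ℝ(E)` and `U ⊆ E` is a real subspace with `U + σ(q)(U) = E` for every
unit imaginary quaternion `q` (i.e. `U` is generic), then `dim_ℝ U ≥ 2k + 1`; equivalently,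
any generic subspace has codimension at most `2k - 1`. -/
theorem stmt_8 (k : ℕ) (hk : 0 < k) (E : Type) [AddCommGroup E] [Module ℝ E]
    [FiniteDimensional ℝ E] (hE : Module.finrank ℝ E = 4 * k)
    (σ : Quaternion ℝ →ₐ[ℝ] Module.End ℝ E) (U : Submodule ℝ E)
    (hU : ∀ q : Quaternion ℝ, q.re = 0 → ‖q‖ = 1 → U ⊔ U.map (σ q) = ⊤) :
    2 * k + 1 ≤ Module.finrank ℝ U := by
  by_contra hlt
  have hd : 2 * Module.finrank ℝ U ≤ Module.finrank ℝ E := by omega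
  obtain ⟨i, hi₀, hi₁, hi₂, hi₃⟩ : ∃ i : Quaternion ℝ,
      i.re = 0 ∧ i.imI = 1 ∧ i.imJ = 0 ∧ i.imK = 0 := ⟨⟨0, 1, 0, 0⟩, rfl, rfl, rfl, rfl⟩
  obtain ⟨j, hj₀, hj₁, hj₂, hj₃⟩ : ∃ j : Quaternion ℝ,
      j.re = 0 ∧ j.imI = 0 ∧ j.imJ = 1 ∧ j.imK = 0 := ⟨⟨0, 0, 1, 0⟩, rfl, rfl, rfl, rfl⟩
  have hi : ‖i‖ = 1 := by
    rw [← sq_eq_sq₀ (norm_nonneg _) zero_le_one, sq, ← Quaternion.normSq_eq_norm_mul_self,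
      Quaternion.normSq_def']
    simp [hi₀, hi₁, hi₂, hi₃]
  have hii : i * i = -1 := by
    apply Quaternion.ext <;> simp [hi₀, hi₁, hi₂, hi₃] <;> rfl
  have hjj : j * j = -1 := by
    apply Quaternion.ext <;> simp [hj₀, hj₁, hj₂, hj₃] <;> rfl
  have hji : j * i = -(i * j) := by
    apply Quaternion.ext <;> simp [hi₀, hi₁, hi₂, hi₃, hj₀, hj₁, hj₂, hj₃]
  have hII (x : E) : σ i (σ i x) = -x := by
    rw [← Module.End.mul_apply, ← map_mul, hii]; simp
  have hJJ (x : E) : σ j (σ j x) = -x := by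
    rw [← Module.End.mul_apply, ← map_mul, hjj]; simp
  have hJI (x : E) : σ j (σ i x) = -σ i (σ j x) := by
    rw [← Module.End.mul_apply, ← map_mul, hji]; simp
  have hbij := Submodule.bijective_coprod_of_sup_map_eq_top (hU i hi₀ hi) hd
  let e := LinearEquiv.ofBijective _ hbij
  let D : U →ₗ[ℝ] U × U := e.symm.toLinearMap ∘ₗ σ j ∘ₗ U.subtype
  let A : Module.End ℝ U := LinearMap.fst ℝ U U ∘ₗ D
  let B : Module.End ℝ U := LinearMap.snd ℝ U U ∘ₗ D
  have hAB (u : U) : σ j u = A u + σ i (B u) := by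
    have : e (D u) = σ j u := by simp [D]
    rw [← this]; rfl
  have hcomm : Commute A B := by
    refine LinearMap.ext fun u => ?_
    have h1 : U.subtype.coprod (σ i ∘ₗ U.subtype) (A (A u) + B (B u), B (A u) - A (B u))
        = U.subtype.coprod (σ i ∘ₗ U.subtype) (-u, 0) := by
      have h2 := hJJ u
      rw [hAB, map_add, hJI, hAB, hAB, map_add, hII] at h2
      simp only [LinearMap.coprod_apply, LinearMap.comp_apply, Submodule.subtype_apply,
        Submodule.coe_add, Submodule.coe_neg, map_sub, map_zero, add_zero]
      rw [← h2]
      abel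
    have h3 := congrArg Prod.snd (hbij.1 h1)
    exact (sub_eq_zero.mp h3).symm
  have hU0 : Nontrivial U := by
    apply Module.nontrivial_of_finrank_pos (R := ℝ)
    have := LinearMap.finrank_le_finrank_of_surjective hbij.2
    rw [Module.finrank_prod] at this
    omega
  obtain ⟨a, b, c, v, hbc, hv, habc⟩ := hcomm.exists_singular_combination
  let q : Quaternion ℝ := a • i + c • j + b • (i * j)
  have hq0 : q ≠ 0 := by
    intro h0
    have hJ := congrArg (fun x : Quaternion ℝ => x.imJ) h0
    have hK := congrArg (fun x : Quaternion ℝ => x.imK) h0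
    simp [q, hi₀, hi₁, hi₂, hi₃, hj₀, hj₁, hj₂, hj₃] at hJ hK
    tauto
  have hqv : σ q v = c • A v - b • B v := by
    have h4 : (a • v + b • A v + c • B v : E) = 0 := by
      exact_mod_cast congrArg Subtype.val habc
    have h5 := congrArg (σ i) h4
    simp only [map_add, map_smul, map_zero] at h5
    simp only [q, map_add, map_smul, map_mul, LinearMap.add_apply, LinearMap.smul_apply,
      Module.End.mul_apply, hAB, hII, smul_add, smul_neg]
    rw [← sub_eq_zero, ← h5]
    abel
  have hn : ‖‖q‖⁻¹ • q‖ = 1 := by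
    rw [norm_smul, norm_inv, norm_norm, inv_mul_cancel₀ (norm_ne_zero_iff.mpr hq0)]
  have hre : (‖q‖⁻¹ • q).re = 0 := by simp [q, hi₀, hi₁, hi₂, hi₃, hj₀, hj₁, hj₂, hj₃]
  have hinj := (Submodule.bijective_coprod_of_sup_map_eq_top (hU _ hre hn) hd).1
  have h6 := hinj (a₁ := (‖q‖⁻¹ • (c • A v - b • B v), -v)) (a₂ := 0) (by
    simp only [LinearMap.coprod_apply, LinearMap.comp_apply, Submodule.subtype_apply, map_neg,
      map_zero, map_smul, LinearMap.smul_apply, hqv, Submodule.coe_smul, Submodule.coe_sub,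
      add_neg_cancel])
  exact hv (neg_eq_zero.mp (congrArg Prod.snd h6))
end

section
/- Let k be a positive integer, let E be a real vector space with dim_ℝ E = 4k endowed with a linear quaternionic structure given by a morphism of unital ℝ-algebras σ : ℍ → End_ℝ(E), and let K ⊆ E be a real subspace such that K ∩ σ(q)(K) = {0} for every unit imaginary quaternion q. Then dim_ℝ K ≤ 2k − 1. (By duality this is the dimension bound for linear co-CR quaternionic structures: if ρ : E → U is a surjective linear map whose kernel K satisfies the above condition, then dim_ℝ U ≥ 2k + 1.) -/
open scoped TensorProduct Quaternion

/-- Two commuting endomorphisms of a nonzero finite-dimensional real vector space have a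
nontrivial real linear combination with a real eigenvalue. -/
theorem Module.End.exists_smul_add_smul_add_smul_eq_zero {V : Type*} [AddCommGroup V] [Module ℝ V]
    [FiniteDimensional ℝ V] [Nontrivial V] {A B : Module.End ℝ V} (hAB : Commute A B) :
    ∃ a b c : ℝ, (b ≠ 0 ∨ c ≠ 0) ∧ ∃ x : V, x ≠ 0 ∧ a • x + b • B x + c • A x = 0 := by
  obtain ⟨α, hα⟩ := Module.End.exists_eigenvalue (A.baseChange ℂ : Module.End ℂ (ℂ ⊗[ℝ] V))
  have hcomm : Commute (A.baseChange ℂ : Module.End ℂ (ℂ ⊗[ℝ] V)) (B.baseChange ℂ) := by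
    rw [commute_iff_eq, ← LinearMap.baseChange_mul, hAB.eq, LinearMap.baseChange_mul]
  let W := Module.End.eigenspace (A.baseChange ℂ : Module.End ℂ (ℂ ⊗[ℝ] V)) α
  have hmaps : ∀ w ∈ W, B.baseChange ℂ w ∈ W :=
    Module.End.mapsTo_genEigenspace_of_comm hcomm α 1
  have : Nontrivial W := Submodule.nontrivial_iff_ne_bot.2 hα
  obtain ⟨β, hβ⟩ := Module.End.exists_eigenvalue ((B.baseChange ℂ).restrict hmaps)
  obtain ⟨w, hw⟩ := hβ.exists_hasEigenvector
  have hwB : B.baseChange ℂ (w : ℂ ⊗[ℝ] V) = β • (w : ℂ ⊗[ℝ] V) :=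
    congrArg Subtype.val hw.apply_eq_smul
  have hwA : A.baseChange ℂ (w : ℂ ⊗[ℝ] V) = α • (w : ℂ ⊗[ℝ] V) :=
    Module.End.mem_eigenspace_iff.1 w.2
  have hw0 : (w : ℂ ⊗[ℝ] V) ≠ 0 := fun h => hw.2 (Subtype.ext h)
  obtain ⟨b, c, hbc, him⟩ : ∃ b c : ℝ, (b ≠ 0 ∨ c ≠ 0) ∧ b * β.im + c * α.im = 0 := by
    by_cases h : α.im = 0
    · exact ⟨0, 1, Or.inr one_ne_zero, by simp [h]⟩
    · exact ⟨α.im, -β.im, Or.inl h, by ring⟩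
  refine ⟨-(b * β.re + c * α.re), b, c, hbc, ?_⟩
  set T : Module.End ℝ V := (-(b * β.re + c * α.re)) • LinearMap.id + b • B + c • A with hT
  have hTw : T.baseChange ℂ (w : ℂ ⊗[ℝ] V) = 0 := by
    have hcoef : ((-(b * β.re + c * α.re) : ℝ) : ℂ) + b * β + c * α = 0 := by
      apply Complex.ext <;> simp
      linarith
    rw [hT]
    simp only [LinearMap.baseChange_add, LinearMap.baseChange_smul, LinearMap.add_apply,
      LinearMap.smul_apply, hwA, hwB, LinearMap.baseChange_id, LinearMap.id_apply]
    rw [← algebraMap_smul ℂ (-(b * β.re + c * α.re)), ← algebraMap_smul ℂ b,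
      ← algebraMap_smul ℂ c, Complex.coe_algebraMap, smul_smul, smul_smul,
      ← add_smul, ← add_smul, hcoef, zero_smul]
  have hdet : LinearMap.det T = 0 := by
    have h : LinearMap.det (T.baseChange ℂ) = 0 := by
      by_contra hne
      have hker := (LinearMap.equivOfDetNeZero _ hne).injective
      exact hw0 (hker (hTw.trans (map_zero _).symm))
    rw [LinearMap.det_baseChange] at h
    simpa using h
  obtain ⟨x, hx, hx0⟩ :=
    Submodule.exists_mem_ne_zero_of_ne_bot (LinearMap.bot_lt_ker_of_det_eq_zero hdet).ne'
  exact ⟨x, hx0, by simpa [hT] using hx⟩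

/-- A subspace meeting each of its images under the admissible complex structures trivially
contains no nonzero vector sent into it by a nonzero imaginary quaternion. -/
theorem Quaternion.eq_zero_of_apply_mem {E : Type*} [AddCommGroup E] [Module ℝ E]
    {σ : Quaternion ℝ →ₐ[ℝ] Module.End ℝ E} {K : Submodule ℝ E}
    (hK : ∀ q : Quaternion ℝ, q.re = 0 → ‖q‖ = 1 → K ⊓ K.map (σ q) = ⊥)
    {q : Quaternion ℝ} (hre : q.re = 0) (hq : q ≠ 0) {x : E} (hx : x ∈ K) (hqx : σ q x ∈ K) :
    x = 0 := by
  have hn : ‖q‖ ≠ 0 := norm_ne_zero_iff.2 hq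
  have hmem : x ∈ K.map (σ (‖q‖⁻¹ • q)) := by
    refine ⟨-(‖q‖⁻¹ • σ q x), K.neg_mem (K.smul_mem _ hqx), ?_⟩
    have hqq : q * q = -((‖q‖ * ‖q‖ : ℝ) : Quaternion ℝ) := by
      have hstar : star q = -q := by ext <;> simp [hre]
      rw [← Quaternion.normSq_eq_norm_mul_self, ← Quaternion.self_mul_star, hstar, mul_neg, neg_neg]
    have hσ : σ q (σ q x) = -((‖q‖ * ‖q‖) • x) := by
      rw [← Module.End.mul_apply, ← map_mul, hqq, map_neg, ← Quaternion.algebraMap_def,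
        AlgHom.commutes, LinearMap.neg_apply, Module.algebraMap_end_apply]
    rw [map_smul, LinearMap.smul_apply, map_neg, map_smul, hσ, smul_neg, smul_neg, smul_neg, neg_neg, smul_smul,
      smul_smul, show ‖q‖⁻¹ * ‖q‖⁻¹ * (‖q‖ * ‖q‖) = 1 by field_simp, one_smul]
  have hbot : x ∈ K ⊓ K.map (σ (‖q‖⁻¹ • q)) := ⟨hx, hmem⟩
  rw [hK _ (by simp [hre]) (by rw [norm_smul, norm_inv, norm_norm, inv_mul_cancel₀ hn])] at hbot
  exact (Submodule.mem_bot ℝ).1 hbot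


/-- If `E` is a real vector space of dimension `4k` with a linear quaternionic
structure `σ : ℍ → End_ℝ(E)` and `K ⊆ E` is a real subspace with `K ∩ σ(q)(K) = 0` for every
unit imaginary quaternion `q`, then `dim_ℝ K ≤ 2k - 1` (the dimension bound for the kernel of a
linear co-CR quaternionic structure). -/
theorem stmt_9 (k : ℕ) (hk : 0 < k) (E : Type) [AddCommGroup E] [Module ℝ E]
    [FiniteDimensional ℝ E] (hE : Module.finrank ℝ E = 4 * k)
    (σ : Quaternion ℝ →ₐ[ℝ] Module.End ℝ E) (K : Submodule ℝ E)
    (hK : ∀ q : Quaternion ℝ, q.re = 0 → ‖q‖ = 1 → K ⊓ K.map (σ q) = ⊥) :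
    Module.finrank ℝ K ≤ 2 * k - 1 := by
  by_contra hlt
  have hdim : 2 * k ≤ Module.finrank ℝ K := by omega
  have : Nontrivial K := Module.nontrivial_of_finrank_pos (R := ℝ) (by omega)
  obtain ⟨i, hi⟩ : ∃ i : Quaternion ℝ, i.re = 0 ∧ i.imI = 1 ∧ i.imJ = 0 ∧ i.imK = 0 :=
    ⟨⟨0, 1, 0, 0⟩, rfl, rfl, rfl, rfl⟩
  obtain ⟨j, hj⟩ : ∃ j : Quaternion ℝ, j.re = 0 ∧ j.imI = 0 ∧ j.imJ = 1 ∧ j.imK = 0 :=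
    ⟨⟨0, 0, 1, 0⟩, rfl, rfl, rfl, rfl⟩
  have hii : i * i = -1 := by apply Quaternion.ext <;> simp [hi]
  have hjj : j * j = -1 := by apply Quaternion.ext <;> simp [hj]
  have hji : j * i = -(i * j) := by apply Quaternion.ext <;> simp [hi, hj]
  have hi2 (x : E) : σ i (σ i x) = -x := by
    rw [← Module.End.mul_apply, ← map_mul, hii, map_neg, map_one, LinearMap.neg_apply,
      Module.End.one_apply]
  have hj2 (x : E) : σ j (σ j x) = -x := by
    rw [← Module.End.mul_apply, ← map_mul, hjj, map_neg, map_one, LinearMap.neg_apply,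
      Module.End.one_apply]
  have hji' (x : E) : σ j (σ i x) = -σ i (σ j x) := by
    rw [← Module.End.mul_apply, ← map_mul, hji, map_neg, map_mul, LinearMap.neg_apply,
      Module.End.mul_apply]
  have hi0 : i ≠ 0 := by rintro rfl; simp at hi
  let L : K × K →ₗ[ℝ] E := K.subtype.coprod (σ i ∘ₗ K.subtype)
  have hL (x y : K) : L (x, y) = x + σ i y := by simp [L]
  have hLinj : Function.Injective L := by
    rw [← LinearMap.ker_eq_bot, LinearMap.ker_eq_bot']
    rintro ⟨x, y⟩ h
    rw [hL] at h
    have hy : (y : E) = 0 := by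
      refine Quaternion.eq_zero_of_apply_mem hK (by simp [hi]) hi0 y.2 ?_
      rw [eq_neg_of_add_eq_zero_right h]
      exact K.neg_mem x.2
    have hx : (x : E) = 0 := by simpa [hy] using h
    exact Prod.ext (Subtype.ext hx) (Subtype.ext hy)
  have hrank : Module.finrank ℝ (K × K) = Module.finrank ℝ E := by
    have hle := LinearMap.finrank_le_finrank_of_injective hLinj
    rw [Module.finrank_prod] at hle ⊢
    omega
  let e : (K × K) ≃ₗ[ℝ] E := LinearEquiv.ofInjectiveOfFinrankEq L hLinj hrank
  have he (z : E) : ((e.symm z).1 : E) + σ i (e.symm z).2 = z := by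
    rw [← hL]
    exact e.apply_symm_apply z
  let A : Module.End ℝ K := LinearMap.fst ℝ K K ∘ₗ e.symm.toLinearMap ∘ₗ σ j ∘ₗ K.subtype
  let B : Module.End ℝ K := LinearMap.snd ℝ K K ∘ₗ e.symm.toLinearMap ∘ₗ σ j ∘ₗ K.subtype
  have hAB (x : K) : σ j x = A x + σ i (B x) := (he (σ j x)).symm
  have hcomm : Commute A B := by
    refine LinearMap.ext fun x => ?_
    have h : L (A (A x) + B (B x) + x, B (A x) - A (B x)) = L 0 := by
      have h2 := hj2 (x : E)
      rw [hAB, map_add, hji', hAB, hAB, map_add, hi2] at h2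
      rw [hL, map_zero]
      push_cast
      rw [map_sub, ← sub_eq_zero.2 h2]
      abel
    exact (sub_eq_zero.1 (congrArg Prod.snd (hLinj h))).symm
  obtain ⟨a, b, c, hbc, x, hx0, hx⟩ := Module.End.exists_smul_add_smul_add_smul_eq_zero hcomm
  obtain ⟨q, hq⟩ : ∃ q : Quaternion ℝ, q = a • i + b • j + c • (i * j) := ⟨_, rfl⟩
  have hre : q.re = 0 := by simp [hq, hi, hj]
  have hq0 : q ≠ 0 := by
    rintro rfl
    have hb := congrArg QuaternionAlgebra.imJ hq
    have hc := congrArg QuaternionAlgebra.imK hq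
    simp [hi, hj] at hb hc
    exact hbc.elim (fun h => h hb.symm) fun h => h hc.symm
  refine hx0 (Subtype.ext (Quaternion.eq_zero_of_apply_mem hK hre hq0 x.2 ?_))
  have hqx : σ q (x : E) = ((b • A x - c • B x : K) : E) := by
    have hx' : a • σ i (x : E) + b • σ i (B x : E) + c • σ i (A x : E) = 0 := by
      simpa using congrArg (fun y : K => σ i (y : E)) hx
    rw [hq]
    simp only [map_add, map_smul, map_mul, LinearMap.add_apply, LinearMap.smul_apply,
      Module.End.mul_apply, hAB, hi2]
    push_cast
    rw [← sub_eq_zero, ← hx']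
    module
  rw [hqx]
  exact Submodule.coe_mem _
end

section
/- Let k and n be positive integers and regard ℍ^k (maps from Fin k to ℍ) as a real normed vector space with the linear quaternionic structure given by componentwise left multiplication by quaternions. Then the set of continuous ℝ-linear maps f : ℝ^n → ℍ^k that are injective and satisfy range(f) + q • range(f) = ℍ^k for every unit imaginary quaternion q (where q • denotes componentwise left multiplication by q) is an open subset of the space of continuous ℝ-linear maps from ℝ^n to ℍ^k with the operator norm topology. (This is the linear-map formulation of the fact that the real subspaces of ℍ^k of a fixed codimension on which ℍ^k induces a linear CR quaternionic structure form an open subset of the Grassmannian.) -/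
/-- Surjectivity is an open condition on continuous linear maps into a finite-dimensional space. -/
lemma ContinuousLinearMap.isOpen_setOfPred_range_eq_top {𝕜 E F : Type*} [NontriviallyNormedField 𝕜]
    [CompleteSpace 𝕜] [NormedAddCommGroup E] [NormedSpace 𝕜 E] [NormedAddCommGroup F]
    [NormedSpace 𝕜 F] [FiniteDimensional 𝕜 F] :
    IsOpen {L : E →L[𝕜] F | LinearMap.range L.toLinearMap = ⊤} := by
  convert isOpen_setOfPred_nat_le_rank (𝕜 := 𝕜) (E := E) (F := F) (Module.finrank 𝕜 F) using 1
  ext L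
  simp only [Set.mem_ofPred_eq, LinearMap.rank, ← Module.finrank_eq_rank, Nat.cast_le]
  refine ⟨fun h => by rw [h, finrank_top], fun h => ?_⟩
  exact Submodule.eq_top_of_finrank_eq (le_antisymm (Submodule.finrank_le _) h)

/-- The set of continuous `ℝ`-linear maps `f : ℝ^n → ℍ^k` which are injective and
whose range `U` satisfies `U + q • U = ℍ^k` for every unit imaginary quaternion `q` (where
`q •` is componentwise left multiplication, i.e. the admissible complex structure
`Algebra.lsmul ℝ ℝ (ℍ^k) q`) is open in the operator-norm topology. -/
theorem stmt_10 (k n : ℕ) (hk : 0 < k) (hn : 0 < n) :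
    IsOpen {f : (Fin n → ℝ) →L[ℝ] (Fin k → Quaternion ℝ) |
      Function.Injective f ∧
      ∀ q : Quaternion ℝ, q.re = 0 → ‖q‖ = 1 →
        LinearMap.range f.toLinearMap ⊔
          (LinearMap.range f.toLinearMap).map
            (Algebra.lsmul ℝ ℝ (Fin k → Quaternion ℝ) q) = ⊤} := by
  let Φ : ((Fin n → ℝ) →L[ℝ] (Fin k → Quaternion ℝ)) × Quaternion ℝ →
      ((Fin n → ℝ) × (Fin n → ℝ) →L[ℝ] (Fin k → Quaternion ℝ)) := fun p =>
    p.1.coprod ((LinearMap.toContinuousLinearMap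
      (Algebra.lsmul ℝ ℝ (Fin k → Quaternion ℝ) p.2)).comp p.1)
  have hΦ : Continuous Φ := by
    rw [continuous_clm_apply]
    rintro ⟨x, y⟩
    change Continuous fun p : ((Fin n → ℝ) →L[ℝ] (Fin k → Quaternion ℝ)) × Quaternion ℝ =>
      p.1 x + p.2 • p.1 y
    fun_prop
  have hrange : ∀ f q, LinearMap.range (Φ (f, q)).toLinearMap =
      LinearMap.range f.toLinearMap ⊔ (LinearMap.range f.toLinearMap).map
        (Algebra.lsmul ℝ ℝ (Fin k → Quaternion ℝ) q) := by
    intro f q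
    rw [← LinearMap.range_comp, ← LinearMap.range_coprod]
    rfl
  have hopen := ContinuousLinearMap.isOpen_setOfPred_range_eq_top.preimage hΦ
  have hcompact : IsCompact {q : Quaternion ℝ | q.re = 0 ∧ ‖q‖ = 1} := by
    have : ProperSpace (Quaternion ℝ) := FiniteDimensional.proper_real _
    refine (isCompact_sphere (0 : Quaternion ℝ) 1).of_isClosed_subset ?_ fun q hq => by
      simpa using hq.2
    exact (isClosed_eq Quaternion.continuous_re continuous_const).inter
      (isClosed_eq continuous_norm continuous_const)
  refine ContinuousLinearMap.isOpen_injective.inter (isOpen_iff_eventually.2 fun f hf => ?_)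
  have := hcompact.eventually_forall_of_forall_eventually
    (x₀ := f) (P := fun g q => LinearMap.range (Φ (g, q)).toLinearMap = ⊤) fun q hq =>
      hopen.mem_nhds (show LinearMap.range (Φ (f, q)).toLinearMap = ⊤ by
        rw [hrange]; exact hf q hq.1 hq.2)
  filter_upwards [this] with g hg q hq₁ hq₂
  rw [← hrange]
  exact hg q ⟨hq₁, hq₂⟩
end

section
/- Let k be a positive integer and regard ℍ^k (maps from Fin k to ℍ) as a left ℍ-module by componentwise left multiplication. Let f : ℍ^k → ℍ^k be an ℝ-linear bijection for which there exists an ℝ-algebra automorphism a of ℍ with f(q • v) = a(q) • f(v) for all q ∈ ℍ and v ∈ ℍ^k. Then there exist a unit quaternion u and an ℍ-linear bijection g : ℍ^k → ℍ^k such that f(v) = u • g(v) for all v ∈ ℍ^k. (This expresses the fact that the automorphism group of the quaternionic vector space ℍ^k is Sp(1)·GL(k, ℍ).) -/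
namespace Quaternion

/-- The averaging operator `x ↦ ∑ₑ a(e) x e⁻¹` over the standard basis `e ∈ {1, i, j, k}`. -/
noncomputable def twistedAverage (a : Quaternion ℝ ≃ₐ[ℝ] Quaternion ℝ) (x : Quaternion ℝ) : Quaternion ℝ :=
  x - a ⟨0, 1, 0, 0⟩ * x * ⟨0, 1, 0, 0⟩ - a ⟨0, 0, 1, 0⟩ * x * ⟨0, 0, 1, 0⟩
    - a ⟨0, 0, 0, 1⟩ * x * ⟨0, 0, 0, 1⟩

theorem map_mul_twistedAverage (a : Quaternion ℝ ≃ₐ[ℝ] Quaternion ℝ) (q x : Quaternion ℝ) :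
    a q * twistedAverage a x = twistedAverage a x * q := by
  unfold twistedAverage
  set i : Quaternion ℝ := ⟨0, 1, 0, 0⟩ with hi
  set j : Quaternion ℝ := ⟨0, 0, 1, 0⟩ with hj
  set k : Quaternion ℝ := ⟨0, 0, 0, 1⟩ with hk
  have hq : q = q.re • 1 + q.imI • i + q.imJ • j + q.imK • k := by
    ext <;> simp <;> simp [hi, hj, hk]
  have hii : i * i = -1 := by ext <;> simp <;> simp [hi]
  have hjj : j * j = -1 := by ext <;> simp <;> simp [hj]
  have hkk : k * k = -1 := by ext <;> simp <;> simp [hk]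
  have hij : i * j = k := by ext <;> simp <;> simp [hi, hj, hk]
  have hji : j * i = -k := by ext <;> simp <;> simp [hi, hj, hk]
  have hjk : j * k = i := by ext <;> simp <;> simp [hi, hj, hk]
  have hkj : k * j = -i := by ext <;> simp <;> simp [hi, hj, hk]
  have hki : k * i = j := by ext <;> simp <;> simp [hi, hj, hk]
  have hik : i * k = -j := by ext <;> simp <;> simp [hi, hj, hk]
  clear_value i j k
  set y := x - a i * x * i - a j * x * j - a k * x * k with hy
  have hyi : a i * y = y * i := by
    rw [hy]
    simp only [mul_sub, sub_mul, ← mul_assoc, ← map_mul, hii, hij, hik]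
    simp only [mul_assoc, hii, hji, hki, map_neg, map_one, neg_mul, mul_neg, one_mul, mul_one]
    abel
  have hyj : a j * y = y * j := by
    rw [hy]
    simp only [mul_sub, sub_mul, ← mul_assoc, ← map_mul, hjj, hji, hjk]
    simp only [mul_assoc, hjj, hij, hkj, map_neg, map_one, neg_mul, mul_neg, one_mul, mul_one]
    abel
  have hyk : a k * y = y * k := by
    rw [hy]
    simp only [mul_sub, sub_mul, ← mul_assoc, ← map_mul, hkk, hki, hkj]
    simp only [mul_assoc, hkk, hik, hjk, map_neg, map_one, neg_mul, mul_neg, one_mul, mul_one]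
    abel
  rw [hq]
  simp only [map_add, map_smul, map_one, add_mul, mul_add, smul_mul_assoc, mul_smul_comm,
    hyi, hyj, hyk, one_mul, mul_one]

theorem exists_twistedAverage_ne_zero (a : Quaternion ℝ ≃ₐ[ℝ] Quaternion ℝ) :
    ∃ x, twistedAverage a x ≠ 0 := by
  by_contra! h
  let i : Quaternion ℝ := ⟨0, 1, 0, 0⟩
  let j : Quaternion ℝ := ⟨0, 0, 1, 0⟩
  let k : Quaternion ℝ := ⟨0, 0, 0, 1⟩
  have key : twistedAverage a 1 - twistedAverage a i * i - twistedAverage a j * j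
      - twistedAverage a k * k = ((4 : ℝ) : Quaternion ℝ) := by
    change (1 - a i * 1 * i - a j * 1 * j - a k * 1 * k)
      - (i - a i * i * i - a j * i * j - a k * i * k) * i
      - (j - a i * j * i - a j * j * j - a k * j * k) * j
      - (k - a i * k * i - a j * k * j - a k * k * k) * k = ((4 : ℝ) : Quaternion ℝ)
    generalize a i = A
    generalize a j = B
    generalize a k = C
    ext <;> simp <;> simp [i, j, k] <;> ring
  simpa [h] using congrArg (fun q : Quaternion ℝ => q.re) key

/-- Every `ℝ`-algebra automorphism of the quaternions is conjugation by a unit quaternion. -/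
theorem exists_norm_eq_one_map_mul_eq (a : Quaternion ℝ ≃ₐ[ℝ] Quaternion ℝ) :
    ∃ u : Quaternion ℝ, ‖u‖ = 1 ∧ ∀ q, a q * u = u * q := by
  obtain ⟨x, hx⟩ := exists_twistedAverage_ne_zero a
  refine ⟨‖twistedAverage a x‖⁻¹ • twistedAverage a x, ?_, fun q => ?_⟩
  · rw [norm_smul, norm_inv, norm_norm, inv_mul_cancel₀ (norm_ne_zero_iff.mpr hx)]
  · rw [mul_smul_comm, smul_mul_assoc, map_mul_twistedAverage]

end Quaternion

/-- Any `ℝ`-linear bijection `f` of `ℍ^k` (a left `ℍ`-module by componentwise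
left multiplication) intertwining the `ℍ`-action up to an `ℝ`-algebra automorphism `a` of `ℍ`
factors as `f = u • g` with `u` a unit quaternion and `g` an `ℍ`-linear bijection: the
automorphism group of the quaternionic vector space `ℍ^k` is `Sp(1)·GL(k, ℍ)`. -/
theorem stmt_11 (k : ℕ) (hk : 0 < k)
    (f : (Fin k → Quaternion ℝ) →ₗ[ℝ] (Fin k → Quaternion ℝ))
    (hf : Function.Bijective f)
    (a : Quaternion ℝ ≃ₐ[ℝ] Quaternion ℝ)
    (ha : ∀ (q : Quaternion ℝ) (v : Fin k → Quaternion ℝ), f (q • v) = a q • f v) :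
    ∃ u : Quaternion ℝ, ‖u‖ = 1 ∧
      ∃ g : (Fin k → Quaternion ℝ) →ₗ[Quaternion ℝ] (Fin k → Quaternion ℝ),
        Function.Bijective g ∧ ∀ v, f v = u • g v := by
  obtain ⟨u, hu, h⟩ := Quaternion.exists_norm_eq_one_map_mul_eq a
  have hu0 : u ≠ 0 := norm_ne_zero_iff.mp (by simp [hu])
  refine ⟨u, hu, ⟨⟨fun v => u⁻¹ • f v, fun v w => by rw [map_add, smul_add]⟩, fun q v => ?_⟩,
    (MulAction.bijective₀ (inv_ne_zero hu0)).comp hf, fun v => (smul_inv_smul₀ hu0 (f v)).symm⟩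
  have hq : u⁻¹ * a q = q * u⁻¹ := by
    rw [inv_mul_eq_iff_eq_mul₀ hu0, ← mul_assoc, eq_mul_inv_iff_mul_eq₀ hu0, h]
  simp only [ha, smul_smul, hq, RingHom.id_apply]
end
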